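/- arXiv:1712.09743 — 2 statements merged into one kernel-verified Lean document; each statement's English description precedes it below -/
import Mathlib

section
/- Suppose assumptions (H1) and (H2) hold at a feasible point z̄ = (x̄, ū) of (MCP). Then for every v ∈ L^∞([0,1], ℝ) there exists a pair (x, u) ∈ C([0,1], ℝⁿ) × L^∞([0,1], ℝˡ) satisfying the linearized state equation x(t) = ∫₀ᵗ (φ_x[s] x(s) + φ_u[s] u(s)) ds for all t ∈ [0,1] together with g_x[t] x(t) + g_u[t] u(t) = v(t) for a.e. t ∈ [0,1]. -/
open Filter Topology MeasureTheory

/-- Lebesgue measure restricted to `[0,1]`. -/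
noncomputable def mu01 : Measure ℝ := volume.restrict (Set.Icc (0:ℝ) 1)

/-- Assumption (H1) for the data `L = (L₁,…,L_m)`, `φ`, `g` of problem (MCP). -/
def HypH1 {n l m : ℕ}
    (L : Fin m → ℝ → (Fin n → ℝ) × (Fin l → ℝ) → ℝ)
    (φ : ℝ → (Fin n → ℝ) × (Fin l → ℝ) → (Fin n → ℝ))
    (g : ℝ → (Fin n → ℝ) × (Fin l → ℝ) → ℝ) : Prop :=
  (∀ j p, Measurable (fun t => L j t p)) ∧
  (∀ᵐ t ∂mu01, ∀ j, ContDiff ℝ 2 (L j t)) ∧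
  Continuous (Function.uncurry φ) ∧ Continuous (Function.uncurry g) ∧
  (∀ t, ContDiff ℝ 2 (φ t)) ∧ (∀ t, ContDiff ℝ 2 (g t)) ∧
  (∀ M > (0:ℝ), ∃ k > (0:ℝ), ∀ᵐ t ∂mu01, ∀ j p₁ p₂, ‖p₁‖ ≤ M → ‖p₂‖ ≤ M →
    |L j t p₁ - L j t p₂| + ‖fderiv ℝ (L j t) p₁ - fderiv ℝ (L j t) p₂‖ +
      ‖fderiv ℝ (fderiv ℝ (L j t)) p₁ - fderiv ℝ (fderiv ℝ (L j t)) p₂‖ ≤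
      k * ‖p₁ - p₂‖) ∧
  (∀ M > (0:ℝ), ∃ k > (0:ℝ), ∀ (t : ℝ) p₁ p₂, ‖p₁‖ ≤ M → ‖p₂‖ ≤ M →
    ‖φ t p₁ - φ t p₂‖ + |g t p₁ - g t p₂| +
      ‖fderiv ℝ (φ t) p₁ - fderiv ℝ (φ t) p₂‖ + ‖fderiv ℝ (g t) p₁ - fderiv ℝ (g t) p₂‖ +
      ‖fderiv ℝ (fderiv ℝ (φ t)) p₁ - fderiv ℝ (fderiv ℝ (φ t)) p₂‖ +
      ‖fderiv ℝ (fderiv ℝ (g t)) p₁ - fderiv ℝ (fderiv ℝ (g t)) p₂‖ ≤ k * ‖p₁ - p₂‖) ∧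
  (∃ C : ℝ, ∀ᵐ t ∂mu01, ∀ j,
    |L j t 0| + ‖fderiv ℝ (L j t) 0‖ + ‖fderiv ℝ (fderiv ℝ (L j t)) 0‖ ≤ C) ∧
  (∃ C : ℝ, ∀ᵐ t ∂mu01,
    ‖φ t 0‖ + |g t 0| + ‖fderiv ℝ (φ t) 0‖ + ‖fderiv ℝ (g t) 0‖ +
      ‖fderiv ℝ (fderiv ℝ (φ t)) 0‖ + ‖fderiv ℝ (fderiv ℝ (g t)) 0‖ ≤ C)

/-- Assumption (H2) at `(x̄, ū)`. -/
def HypH2 {n l : ℕ} (g : ℝ → (Fin n → ℝ) × (Fin l → ℝ) → ℝ)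
    (xb : ℝ → Fin n → ℝ) (ub : ℝ → Fin l → ℝ) : Prop :=
  ∃ i₀ : Fin l, ∃ α > (0:ℝ), ∀ᵐ t ∂mu01,
    α ≤ |fderiv ℝ (g t) (xb t, ub t) (0, Pi.single i₀ 1)|

/-- Feasibility for (MCP). -/
def FeasibleMCP {n l : ℕ}
    (φ : ℝ → (Fin n → ℝ) × (Fin l → ℝ) → (Fin n → ℝ))
    (g : ℝ → (Fin n → ℝ) × (Fin l → ℝ) → ℝ) (x₀ : Fin n → ℝ)
    (x : ℝ → Fin n → ℝ) (u : ℝ → Fin l → ℝ) : Prop :=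
  ContinuousOn x (Set.Icc 0 1) ∧ Measurable u ∧
  (∃ C : ℝ, ∀ᵐ t ∂mu01, ‖u t‖ ≤ C) ∧
  (∀ t ∈ Set.Icc (0:ℝ) 1, x t = x₀ + ∫ s in (0:ℝ)..t, φ s (x s, u s)) ∧
  (∀ᵐ t ∂mu01, g t (x t, u t) ≤ 0)

/-- A Carathéodory vector field on `[0,1]`, uniformly Lipschitz in the state, has an integral
curve starting from the origin. -/
theorem exists_integral_curve_of_lipschitz {E : Type*} [NormedAddCommGroup E] [NormedSpace ℝ E]
    [CompleteSpace E] (f : ℝ → E → E) (K : ℝ) (hK : 0 ≤ K)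
    (hint : ∀ y : ℝ → E, Continuous y → IntegrableOn (fun s => f s (y s)) (Set.Icc 0 1))
    (hlip : ∀ᵐ s ∂mu01, ∀ y z, ‖f s y - f s z‖ ≤ K * ‖y - z‖) :
    ∃ x : ℝ → E, Continuous x ∧ ∀ t ∈ Set.Icc (0:ℝ) 1, x t = ∫ s in (0:ℝ)..t, f s (x s) := by
  let ext (x : C(Set.Icc (0:ℝ) 1, E)) : ℝ → E := Set.IccExtend zero_le_one x
  have hext (x : C(Set.Icc (0:ℝ) 1, E)) : Continuous (ext x) := x.continuous.Icc_extend'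
  have hsub {t : ℝ} (ht : t ∈ Set.Icc (0:ℝ) 1) : Set.uIcc 0 t ⊆ Set.Icc 0 1 := by
    rw [Set.uIcc_of_le ht.1]
    exact Set.Icc_subset_Icc_right ht.2
  have hii (x : C(Set.Icc (0:ℝ) 1, E)) {t : ℝ} (ht : t ∈ Set.Icc (0:ℝ) 1) :
      IntervalIntegrable (fun s => f s (ext x s)) volume 0 t :=
    ((hint _ (hext x)).mono_set (hsub ht)).intervalIntegrable
  have hcont (x : C(Set.Icc (0:ℝ) 1, E)) :
      ContinuousOn (fun t => ∫ s in (0:ℝ)..t, f s (ext x s)) (Set.Icc 0 1) := by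
    have h := hint _ (hext x)
    rw [← Set.uIcc_of_le (zero_le_one' ℝ)] at h ⊢
    exact intervalIntegral.continuousOn_primitive_interval h
  let F (x : C(Set.Icc (0:ℝ) 1, E)) : C(Set.Icc (0:ℝ) 1, E) :=
    ⟨fun t => ∫ s in (0:ℝ)..t, f s (ext x s), (hcont x).domRestrict⟩
  have hiter (x y : C(Set.Icc (0:ℝ) 1, E)) (k : ℕ) (t : Set.Icc (0:ℝ) 1) :
      ‖F^[k] x t - F^[k] y t‖ ≤ (K * t) ^ k / (k.factorial : ℝ) * dist x y := by
    induction k generalizing t with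
    | zero =>
      simpa [dist_eq_norm] using ContinuousMap.dist_apply_le_dist (f := x) (g := y) t
    | succ k ih =>
      rw [Function.iterate_succ_apply', Function.iterate_succ_apply']
      have hval : ∫ s in (0:ℝ)..t, K * ((K * s) ^ k / (k.factorial : ℝ) * dist x y) =
          (K * t) ^ (k + 1) / ((k + 1).factorial : ℝ) * dist x y := by
        have hfun : (fun s : ℝ => K * ((K * s) ^ k / (k.factorial : ℝ) * dist x y)) =
            fun s => (K ^ (k + 1) / (k.factorial : ℝ) * dist x y) * s ^ k := by
          funext s
          rw [mul_pow]
          ring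
        rw [hfun, intervalIntegral.integral_const_mul, integral_pow, Nat.factorial_succ, mul_pow]
        push_cast
        have : (k.factorial : ℝ) ≠ 0 := by positivity
        field_simp
        simp
      have heq : F (F^[k] x) t - F (F^[k] y) t =
          ∫ s in (0:ℝ)..t, (f s (ext (F^[k] x) s) - f s (ext (F^[k] y) s)) :=
        (intervalIntegral.integral_sub (hii _ t.2) (hii _ t.2)).symm
      rw [heq, ← hval]
      refine intervalIntegral.norm_integral_le_of_norm_le t.2.1 ?_
        (Continuous.intervalIntegrable (by fun_prop) _ _)
      filter_upwards [(ae_restrict_iff' measurableSet_Icc).1 hlip] with s hs hst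
      have hs1 : s ∈ Set.Icc (0:ℝ) 1 := ⟨hst.1.le, hst.2.trans t.2.2⟩
      refine (hs hs1 _ _).trans (mul_le_mul_of_nonneg_left ?_ hK)
      simpa [ext, Set.IccExtend_of_mem _ _ hs1] using ih ⟨s, hs1⟩
  obtain ⟨k, hk⟩ := ((FloorSemiring.tendsto_pow_div_factorial_atTop K).eventually
    (gt_mem_nhds (zero_lt_one' ℝ))).exists
  have hcontr : ContractingWith (K ^ k / (k.factorial : ℝ)).toNNReal F^[k] := by
    refine ⟨by simpa using hk, LipschitzWith.of_dist_le_mul fun x y => ?_⟩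
    have h0 : 0 ≤ K ^ k / (k.factorial : ℝ) := by positivity
    rw [Real.coe_toNNReal _ h0, ContinuousMap.dist_le (by positivity)]
    intro t
    rw [dist_eq_norm]
    refine (hiter x y k t).trans ?_
    have := t.2.1
    have : K * t ≤ K := mul_le_of_le_one_right hK t.2.2
    gcongr
  obtain ⟨x, hx⟩ : ∃ x, F x = x := ⟨_, hcontr.isFixedPt_fixedPoint_iterate⟩
  refine ⟨ext x, hext x, fun t ht => ?_⟩
  calc ext x t = x ⟨t, ht⟩ := Set.IccExtend_of_mem _ _ ht
    _ = F x ⟨t, ht⟩ := by rw [hx]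
    _ = _ := rfl

/-- A bound at the origin and a Lipschitz estimate on a ball bound a family on that ball. -/
theorem norm_le_of_norm_zero_le_of_lipschitz {P F : Type*} [NormedAddCommGroup P]
    [NormedAddCommGroup F] {f : P → F} {k C M : ℝ} (hk : 0 ≤ k) {p : P} (hp : ‖p‖ ≤ M)
    (h0 : ‖f 0‖ ≤ C) (hf : ‖f p - f 0‖ ≤ k * ‖p - 0‖) : ‖f p‖ ≤ k * M + C := by
  rw [sub_zero] at hf
  have h1 : ‖f p‖ ≤ ‖f p - f 0‖ + ‖f 0‖ := by simpa using norm_add_le (f p - f 0) (f 0)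
  have h2 := mul_le_mul_of_nonneg_left hp hk
  linarith

theorem Measurable.continuousLinearMap_apply {P F : Type*} [NormedAddCommGroup P]
    [NormedSpace ℝ P] [MeasurableSpace P] [BorelSpace P] [SecondCountableTopology P]
    [NormedAddCommGroup F] [NormedSpace ℝ F] [MeasurableSpace F] [BorelSpace F]
    {A : ℝ → P →L[ℝ] F} {p : ℝ → P} (hA : Measurable A) (hp : Measurable p) :
    Measurable fun t => A t (p t) :=
  isBoundedBilinearMap_apply.continuous.measurable.comp (hA.prodMk hp)

/-- The control in direction `e i` that makes `Dg (y, ·)` equal to `c`. -/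
noncomputable def correctingControl {n l : ℕ} (i : Fin l)
    (G : (Fin n → ℝ) × (Fin l → ℝ) →L[ℝ] ℝ) (c : ℝ) (y : Fin n → ℝ) : Fin l → ℝ :=
  Pi.single i ((c - G (y, 0)) / G (0, Pi.single i 1))

theorem apply_correctingControl {n l : ℕ} {i : Fin l}
    {G : (Fin n → ℝ) × (Fin l → ℝ) →L[ℝ] ℝ} (hG : G (0, Pi.single i 1) ≠ 0) (c : ℝ)
    (y : Fin n → ℝ) : G (y, correctingControl i G c y) = c := by
  set r := (c - G (y, 0)) / G (0, Pi.single i 1) with hr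
  have h1 : (y, correctingControl i G c y) = (y, 0) + r • ((0, Pi.single i 1) :
      (Fin n → ℝ) × (Fin l → ℝ)) := by
    simp [correctingControl, ← hr, ← Pi.single_smul]
  rw [h1, map_add, map_smul, hr, smul_eq_mul, div_mul_cancel₀ _ hG]
  ring

theorem norm_correctingControl_le {n l : ℕ} {i : Fin l}
    {G : (Fin n → ℝ) × (Fin l → ℝ) →L[ℝ] ℝ} {α B C : ℝ} (hα : 0 < α)
    (hG : α ≤ |G (0, Pi.single i 1)|) (hB : ‖G‖ ≤ B) {c : ℝ} (hc : |c| ≤ C)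
    (y : Fin n → ℝ) : ‖correctingControl i G c y‖ ≤ (C + B * ‖y‖) / α := by
  have h1 : ‖G (y, 0)‖ ≤ B * ‖y‖ := by
    simpa [Prod.norm_def] using G.le_of_opNorm_le hB (y, 0)
  have h2 : |c - G (y, 0)| ≤ C + B * ‖y‖ := by
    rw [Real.norm_eq_abs] at h1
    exact (abs_sub _ _).trans (add_le_add hc h1)
  rw [correctingControl, Pi.norm_single, Real.norm_eq_abs, abs_div]
  exact div_le_div₀ ((abs_nonneg _).trans h2) h2 hα hG

theorem correctingControl_sub {n l : ℕ} (i : Fin l)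
    (G : (Fin n → ℝ) × (Fin l → ℝ) →L[ℝ] ℝ) (c : ℝ) (y z : Fin n → ℝ) :
    correctingControl i G c y - correctingControl i G c z = correctingControl i G 0 (y - z) := by
  have h : G (y - z, 0) = G (y, 0) - G (z, 0) := by rw [← map_sub]; simp
  rw [correctingControl, correctingControl, correctingControl, ← Pi.single_sub, h]
  congr 1
  ring

/-- Under (H1)–(H2) at a feasible point `(x̄, ū)` of (MCP), the linearized constraint
map is surjective: for every `v ∈ L^∞([0,1],ℝ)` there is a pair `(x, u)` in
`C([0,1],ℝⁿ) × L^∞([0,1],ℝˡ)` solving the linearized state equation together with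
`g_x[t]x(t) + g_u[t]u(t) = v(t)` a.e. -/
theorem linearized_constraint_surjective {n l m : ℕ}
    (L : Fin m → ℝ → (Fin n → ℝ) × (Fin l → ℝ) → ℝ)
    (φ : ℝ → (Fin n → ℝ) × (Fin l → ℝ) → (Fin n → ℝ))
    (g : ℝ → (Fin n → ℝ) × (Fin l → ℝ) → ℝ)
    (x₀ : Fin n → ℝ) (xb : ℝ → Fin n → ℝ) (ub : ℝ → Fin l → ℝ)
    (hH1 : HypH1 L φ g) (hH2 : HypH2 g xb ub)
    (hfeas : FeasibleMCP φ g x₀ xb ub) :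
    ∀ v : ℝ → ℝ, Measurable v → (∃ C : ℝ, ∀ᵐ t ∂mu01, |v t| ≤ C) →
      ∃ (x : ℝ → Fin n → ℝ) (u : ℝ → Fin l → ℝ),
        ContinuousOn x (Set.Icc 0 1) ∧ Measurable u ∧
        (∃ C : ℝ, ∀ᵐ t ∂mu01, ‖u t‖ ≤ C) ∧
        (∀ t ∈ Set.Icc (0:ℝ) 1,
          x t = ∫ s in (0:ℝ)..t, fderiv ℝ (φ s) (xb s, ub s) (x s, u s)) ∧
        (∀ᵐ t ∂mu01, fderiv ℝ (g t) (xb t, ub t) (x t, u t) = v t) := by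
  rintro v hv ⟨Cv, hCv⟩
  obtain ⟨-, -, hφc, hgc, -, -, -, hLip, -, C0, hC0⟩ := hH1
  obtain ⟨i, α, hα, hαg⟩ := hH2
  obtain ⟨hxb, hub, ⟨Cu, hCu⟩, -, -⟩ := hfeas
  -- a continuous extension of the reference state to the whole line
  let xe : ℝ → Fin n → ℝ := Set.IccExtend zero_le_one ((Set.Icc (0:ℝ) 1).domRestrict xb)
  have hxe : Continuous xe := hxb.domRestrict.Icc_extend'
  have hxe_eq {t : ℝ} (ht : t ∈ Set.Icc (0:ℝ) 1) : xe t = xb t :=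
    Set.IccExtend_of_mem _ _ ht
  let Φ : ℝ → (Fin n → ℝ) × (Fin l → ℝ) →L[ℝ] (Fin n → ℝ) := fun t => fderiv ℝ (φ t) (xe t, ub t)
  let G : ℝ → (Fin n → ℝ) × (Fin l → ℝ) →L[ℝ] ℝ := fun t => fderiv ℝ (g t) (xe t, ub t)
  have hpt : Measurable fun t => (t, (xe t, ub t)) :=
    measurable_id.prodMk (hxe.measurable.prodMk hub)
  have hΦm : Measurable Φ := (measurable_fderiv_with_param ℝ hφc).comp hpt
  have hGm : Measurable G := (measurable_fderiv_with_param ℝ hgc).comp hpt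
  have hmem : ∀ᵐ t ∂mu01, t ∈ Set.Icc (0:ℝ) 1 := ae_restrict_mem measurableSet_Icc
  have hbdd (y : ℝ → Fin n → ℝ) (hy : Continuous y) : ∃ C, ∀ t ∈ Set.Icc (0:ℝ) 1, ‖y t‖ ≤ C :=
    isCompact_Icc.exists_bound_of_continuousOn hy.continuousOn
  obtain ⟨B, hB⟩ : ∃ B, ∀ᵐ t ∂mu01, ‖Φ t‖ ≤ B ∧ ‖G t‖ ≤ B := by
    obtain ⟨Cx, hCx⟩ := hbdd xe hxe
    obtain ⟨k, hk, hlip⟩ := hLip (max 1 (max Cx Cu)) (by positivity)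
    refine ⟨k * max 1 (max Cx Cu) + C0, ?_⟩
    filter_upwards [hmem, hCu, hC0] with t ht hu h0
    have hp : ‖(xe t, ub t)‖ ≤ max 1 (max Cx Cu) :=
      (max_le_max (hCx t ht) hu).trans (le_max_right _ _)
    have hl := hlip t (xe t, ub t) 0 hp (by simp)
    constructor
    · refine norm_le_of_norm_zero_le_of_lipschitz (f := fderiv ℝ (φ t)) hk.le hp ?_ ?_
      · refine le_trans ?_ h0
        linarith [norm_nonneg (φ t 0), abs_nonneg (g t 0), norm_nonneg (fderiv ℝ (g t) 0),
          norm_nonneg (fderiv ℝ (fderiv ℝ (φ t)) 0), norm_nonneg (fderiv ℝ (fderiv ℝ (g t)) 0)]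
      · refine le_trans ?_ hl
        linarith [norm_nonneg (φ t (xe t, ub t) - φ t 0), abs_nonneg (g t (xe t, ub t) - g t 0),
          norm_nonneg (fderiv ℝ (g t) (xe t, ub t) - fderiv ℝ (g t) 0),
          norm_nonneg (fderiv ℝ (fderiv ℝ (φ t)) (xe t, ub t) - fderiv ℝ (fderiv ℝ (φ t)) 0),
          norm_nonneg (fderiv ℝ (fderiv ℝ (g t)) (xe t, ub t) - fderiv ℝ (fderiv ℝ (g t)) 0)]
    · refine norm_le_of_norm_zero_le_of_lipschitz (f := fderiv ℝ (g t)) hk.le hp ?_ ?_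
      · refine le_trans ?_ h0
        linarith [norm_nonneg (φ t 0), abs_nonneg (g t 0), norm_nonneg (fderiv ℝ (φ t) 0),
          norm_nonneg (fderiv ℝ (fderiv ℝ (φ t)) 0), norm_nonneg (fderiv ℝ (fderiv ℝ (g t)) 0)]
      · refine le_trans ?_ hl
        linarith [norm_nonneg (φ t (xe t, ub t) - φ t 0), abs_nonneg (g t (xe t, ub t) - g t 0),
          norm_nonneg (fderiv ℝ (φ t) (xe t, ub t) - fderiv ℝ (φ t) 0),
          norm_nonneg (fderiv ℝ (fderiv ℝ (φ t)) (xe t, ub t) - fderiv ℝ (fderiv ℝ (φ t)) 0),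
          norm_nonneg (fderiv ℝ (fderiv ℝ (g t)) (xe t, ub t) - fderiv ℝ (fderiv ℝ (g t)) 0)]
  have hB0 : 0 ≤ B := by
    have : NeZero mu01 := ⟨by simp [mu01, Measure.restrict_eq_zero]⟩
    obtain ⟨t, ht, -⟩ := hB.exists
    exact (norm_nonneg _).trans ht
  have hαG : ∀ᵐ t ∂mu01, α ≤ |G t (0, Pi.single i 1)| := by
    filter_upwards [hmem, hαg] with t ht h
    simpa only [G, hxe_eq ht] using h
  let w : ℝ → (Fin n → ℝ) → Fin l → ℝ := fun t y => correctingControl i (G t) (v t) y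
  have hwm (y : ℝ → Fin n → ℝ) (hy : Continuous y) : Measurable fun t => w t (y t) := by
    have h1 : Measurable fun t => G t (y t, 0) :=
      hGm.continuousLinearMap_apply (hy.measurable.prodMk measurable_const)
    have h2 : Measurable fun t => G t (0, Pi.single i 1) := hGm.apply_continuousLinearMap _
    exact (continuous_single i).measurable.comp ((hv.sub h1).div h2)
  have hwb (y : ℝ → Fin n → ℝ) (hy : Continuous y) :
      ∃ C, ∀ᵐ t ∂mu01, ‖w t (y t)‖ ≤ C := by
    obtain ⟨Cy, hCy⟩ := hbdd y hy
    refine ⟨(Cv + B * Cy) / α, ?_⟩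
    filter_upwards [hmem, hCv, hB, hαG] with t ht hvt hBt hαt
    refine (norm_correctingControl_le hα hαt hBt.2 hvt (y t)).trans ?_
    have := hCy t ht
    gcongr
  obtain ⟨x, hxc, hx⟩ := exists_integral_curve_of_lipschitz (fun s y => Φ s (y, w s y))
    (B * (1 + B / α)) (by positivity)
    (by
      intro y hy
      obtain ⟨Cy, hCy⟩ := hbdd y hy
      obtain ⟨Cw, hCw⟩ := hwb y hy
      have hm : Measurable fun s => Φ s (y s, w s (y s)) :=
        hΦm.continuousLinearMap_apply (hy.measurable.prodMk (hwm y hy))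
      have : IsFiniteMeasure mu01 := by unfold mu01; infer_instance
      refine Integrable.of_bound (μ := mu01) hm.aestronglyMeasurable (B * max Cy Cw) ?_
      filter_upwards [hmem, hB, hCw] with s hs hBs hws
      exact (Φ s).le_of_opNorm_le_of_le hBs.1 (max_le_max (hCy s hs) hws))
    (by
      filter_upwards [hB, hαG] with s hBs hαs y z
      have hw : ‖w s y - w s z‖ ≤ B / α * ‖y - z‖ := by
        rw [show w s y - w s z = _ from correctingControl_sub _ _ _ _ _]
        refine (norm_correctingControl_le hα hαs hBs.2 (abs_zero.le) (y - z)).trans_eq ?_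
        ring
      rw [← map_sub, mul_assoc]
      refine (Φ s).le_of_opNorm_le_of_le hBs.1 (max_le ?_ (hw.trans ?_))
      · exact le_mul_of_one_le_left (norm_nonneg _) (le_add_of_nonneg_right (by positivity))
      · gcongr
        linarith)
  refine ⟨x, fun t => w t (x t), hxc.continuousOn, hwm x hxc, hwb x hxc, fun t ht => ?_, ?_⟩
  · rw [hx t ht]
    refine intervalIntegral.integral_congr fun s hs => ?_
    rw [Set.uIcc_of_le ht.1] at hs
    simp only [Φ, hxe_eq ⟨hs.1, hs.2.trans ht.2⟩]
  · filter_upwards [hmem, hαG] with t ht hαt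
    have hne : G t (0, Pi.single i 1) ≠ 0 := abs_pos.1 (hα.trans_le hαt)
    rw [← hxe_eq ht]
    exact apply_correctingControl hne (v t) (x t)
end

section
/- Let Q = {v ∈ L^∞([0,1], ℝ) : v(t) ≤ 0 for a.e. t ∈ [0,1]} and let ḡ ∈ Q. Then the contingent cone to Q at ḡ taken in L^∞([0,1], ℝ) satisfies T(Q; ḡ) ⊆ {v ∈ L^∞([0,1], ℝ) : v(t) ∈ T((−∞,0]; ḡ(t)) for a.e. t ∈ [0,1]}, where T((−∞,0]; a) = ℝ if a < 0 and T((−∞,0]; a) = (−∞,0] if a = 0. -/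
open Filter Topology MeasureTheory

/-- Membership in `Q = {v ∈ L^∞([0,1],ℝ) : v(t) ≤ 0 a.e.}`, for a measurable and
essentially bounded representative. -/
def MemQ (v : ℝ → ℝ) : Prop :=
  Measurable v ∧ (∃ C : ℝ, ∀ᵐ t ∂mu01, |v t| ≤ C) ∧ (∀ᵐ t ∂mu01, v t ≤ 0)

/-- `h` belongs to the contingent cone `T(Q; ḡ)` computed in `L^∞([0,1],ℝ)`:
there are `t_k → 0⁺` and `h_k → h` in the `L^∞` norm with `ḡ + t_k h_k ∈ Q` for all
`k`. -/
def MemContingentConeLinf (gb h : ℝ → ℝ) : Prop :=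
  ∃ t : ℕ → ℝ, ∃ hk : ℕ → ℝ → ℝ,
    (∀ k, 0 < t k) ∧ Tendsto t atTop (𝓝 0) ∧
    (∀ ε > (0:ℝ), ∃ K : ℕ, ∀ k ≥ K, ∀ᵐ s ∂mu01, |hk k s - h s| ≤ ε) ∧
    (∀ k, MemQ (fun s => gb s + t k * hk k s))

/-- The contingent cone to `Q = {v ∈ L^∞ : v ≤ 0 a.e.}` at `ḡ ∈ Q` is contained in
`{v ∈ L^∞ : v(t) ∈ T((−∞,0]; ḡ(t)) a.e.}`, where `T((−∞,0]; a) = ℝ` if `a < 0` and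
`T((−∞,0]; a) = (−∞,0]` if `a = 0`. -/
theorem contingentCone_Linf_subset
    (gb : ℝ → ℝ) (hgb : MemQ gb)
    (h : ℝ → ℝ) (hmeas : Measurable h) (hbdd : ∃ C : ℝ, ∀ᵐ t ∂mu01, |h t| ≤ C)
    (hmem : MemContingentConeLinf gb h) :
    ∀ᵐ t ∂mu01, gb t < 0 ∨ (gb t = 0 ∧ h t ≤ 0) := by
  obtain ⟨t, hk, ht, -, hconv, hQ⟩ := hmem
  have hle : ∀ n : ℕ, ∀ᵐ s ∂mu01, gb s = 0 → h s ≤ 1 / ((n : ℝ) + 1) := by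
    intro n
    obtain ⟨K, hK⟩ := hconv (1 / ((n : ℝ) + 1)) Nat.one_div_pos_of_nat
    filter_upwards [hK K le_rfl, (hQ K).2.2] with s hs hs' hs0
    rw [hs0, zero_add] at hs'
    have hneg : hk K s ≤ 0 := nonpos_of_mul_nonpos_right hs' (ht K)
    linarith [(abs_le.mp hs).1]
  filter_upwards [hgb.2.2, ae_all_iff.mpr hle] with s hs hs'
  rcases hs.lt_or_eq with hlt | heq
  · exact Or.inl hlt
  · exact Or.inr ⟨heq, ge_of_tendsto' tendsto_one_div_add_atTop_nhds_zero_nat fun n => hs' n heq⟩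
end
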